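/- If G admits a popular matching that is not stable, then G admits a dominant matching that is not stable. -/

import Mathlib

open Classical

/-- A bipartite graph `G = (A ∪ B, E)` with strict preference lists:
`adj` is the edge relation, and each vertex ranks its neighbors by a rank
function (lower rank = more preferred), injective on neighbors. -/
structure PrefSys (A B : Type) where
  adj : A → B → Prop
  rankA : A → B → ℕ
  rankB : B → A → ℕ
  rankA_inj : ∀ a b b', adj a b → adj a b' → rankA a b = rankA a b' → b = b'
  rankB_inj : ∀ b a a', adj a b → adj a' b → rankB b a = rankB b a' → a = a'

namespace PrefSys

variable {A B : Type} (P : PrefSys A B)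

/-- `M` is a matching of `G`: a set of edges, no two sharing a vertex. -/
def IsMatching (M : Finset (A × B)) : Prop :=
  (∀ p ∈ M, P.adj p.1 p.2) ∧
  (∀ p ∈ M, ∀ q ∈ M, p.1 = q.1 → p = q) ∧
  (∀ p ∈ M, ∀ q ∈ M, p.2 = q.2 → p = q)

/-- Vertex `a ∈ A` prefers matching `M` to matching `M'`:
`a` is matched in `M` and either unmatched in `M'` or matched to a strictly
worse partner in `M'`. -/
def prefA (M M' : Finset (A × B)) (a : A) : Prop :=
  ∃ b, (a, b) ∈ M ∧ ∀ b', (a, b') ∈ M' → P.rankA a b < P.rankA a b'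

/-- Vertex `b ∈ B` prefers matching `M` to matching `M'`. -/
def prefB (M M' : Finset (A × B)) (b : B) : Prop :=
  ∃ a, (a, b) ∈ M ∧ ∀ a', (a', b) ∈ M' → P.rankB b a < P.rankB b a'

/-- `φ(M, M')`: the number of vertices preferring `M` to `M'`. -/
noncomputable def phi (M M' : Finset (A × B)) : ℕ :=
  Nat.card {a : A // P.prefA M M' a} + Nat.card {b : B // P.prefB M M' b}

/-- A matching is popular if it never loses a head-to-head election. -/
def Popular (M : Finset (A × B)) : Prop :=
  P.IsMatching M ∧ ∀ M', P.IsMatching M' → P.phi M' M ≤ P.phi M M'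

/-- `a`'s vote on the edge `(a,b)` versus its `M`-partner is `+`. -/
def voteAplus (M : Finset (A × B)) (a : A) (b : B) : Prop :=
  ∀ b', (a, b') ∈ M → P.rankA a b < P.rankA a b'

/-- `b`'s vote on the edge `(a,b)` versus its `M`-partner is `+`. -/
def voteBplus (M : Finset (A × B)) (a : A) (b : B) : Prop :=
  ∀ a', (a', b) ∈ M → P.rankB b a < P.rankB b a'

/-- `(a,b)` is a blocking edge (an edge outside `M` labeled `(+,+)`). -/
def Blocking (M : Finset (A × B)) (a : A) (b : B) : Prop :=
  P.adj a b ∧ (a, b) ∉ M ∧ P.voteAplus M a b ∧ P.voteBplus M a b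

/-- A stable matching: a matching with no blocking edge. -/
def Stable (M : Finset (A × B)) : Prop :=
  P.IsMatching M ∧ ∀ a b, ¬ P.Blocking M a b

/-- A dominant matching: popular, and more popular than every larger matching. -/
def Dominant (M : Finset (A × B)) : Prop :=
  P.Popular M ∧ ∀ M', P.IsMatching M' → M.card < M'.card → P.phi M' M < P.phi M M'

/-- The edge `(a,b)` survives in the subgraph `G_M` (i.e. it is an edge of `G`
that is in `M` or is not labeled `(-,-)`). -/
def inGM (M : Finset (A × B)) (a : A) (b : B) : Prop :=
  P.adj a b ∧ ((a, b) ∈ M ∨ P.voteAplus M a b ∨ P.voteBplus M a b)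

end PrefSys

/-- If `d₁` and `d₂` are strict orders on a finite set of edges (beats at the first/second
endpoint), there is a set of edges whose elements do not beat each other and which beats every
edge outside it. -/
theorem exists_stable_set {E : Type*} [Finite E] (d₁ d₂ : E → E → Prop)
    [IsStrictOrder E d₁] [IsStrictOrder E d₂] :
    ∃ S : Set E, (∀ e ∈ S, ∀ f ∈ S, ¬ d₁ e f ∧ ¬ d₂ e f) ∧
      ∀ e, e ∈ S ∨ (∃ f ∈ S, d₁ f e) ∨ ∃ f ∈ S, d₂ f e := by
  let beaten (d : E → E → Prop) (X : Set E) : Set E := {e | ∃ f ∈ X, d f e}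
  have beaten_mono (d : E → E → Prop) {X Y : Set E} (h : X ⊆ Y) : beaten d X ⊆ beaten d Y :=
    fun e ⟨f, hf, hd⟩ => ⟨f, h hf, hd⟩
  have beaten_by_best (d : E → E → Prop) [IsStrictOrder E d] (X : Set E) {e : E}
      (he : e ∈ beaten d X) : ∃ f ∈ X, f ∉ beaten d X ∧ d f e := by
    have wf : WellFounded d := Finite.wellFounded_of_trans_of_irrefl d
    obtain ⟨f, ⟨hfX, hfe⟩, hmin⟩ := wf.has_min {f | f ∈ X ∧ d f e} he
    exact ⟨f, hfX, fun ⟨g, hg, hgf⟩ => hmin g ⟨hg, _root_.trans hgf hfe⟩ hgf, hfe⟩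
  let F : Set E →o Set E :=
    ⟨fun X => (beaten d₂ (beaten d₁ X)ᶜ)ᶜ, fun X Y h =>
      Set.compl_subset_compl.2 (beaten_mono _ (Set.compl_subset_compl.2 (beaten_mono _ h)))⟩
  obtain ⟨X, hX⟩ : ∃ X, (beaten d₂ (beaten d₁ X)ᶜ)ᶜ = X := ⟨F.lfp, F.map_lfp⟩
  have memX (e : E) : e ∈ X ↔ e ∉ beaten d₂ (beaten d₁ X)ᶜ := by
    conv_lhs => rw [← hX]
    rfl
  refine ⟨X \ beaten d₁ X, fun e he f hf => ⟨fun h => hf.2 ⟨e, he.1, h⟩,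
    fun h => (memX f).1 hf.1 ⟨e, he.2, h⟩⟩, fun e => ?_⟩
  by_cases h₁ : e ∈ beaten d₁ X
  · obtain ⟨f, hf, hf', hfe⟩ := beaten_by_best d₁ X h₁
    exact .inr (.inl ⟨f, ⟨hf, hf'⟩, hfe⟩)
  by_cases h₂ : e ∈ X
  · exact .inl ⟨h₂, h₁⟩
  · rw [memX, not_not] at h₂
    obtain ⟨f, hf, hf', hfe⟩ := beaten_by_best d₂ _ h₂
    exact .inr (.inr ⟨f, ⟨(memX f).2 hf', hf⟩, hfe⟩)

/-- Egerváry's duality for the assignment problem, with a relation `R` of admissible entries. -/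
theorem exists_dual_of_assignment_nonpos {V : Type*} [Fintype V] (R : V → V → Prop)
    (w : V → V → ℤ) (σ : Equiv.Perm V) (hσ : ∀ x, R x (σ x))
    (h : ∀ π : Equiv.Perm V, (∀ x, R x (π x)) → ∑ x, w x (π x) ≤ 0) :
    ∃ u v : V → ℤ, (∀ x y, R x y → w x y ≤ u x + v y) ∧ ∑ x, (u x + v x) ≤ 0 := by
  let feasible (p : (V → ℤ) × (V → ℤ)) : Prop := ∀ x y, R x y → w x y ≤ p.1 x + p.2 y
  let total (p : (V → ℤ) × (V → ℤ)) : ℤ := ∑ x, (p.1 x + p.2 x)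
  have bound (p) (hp : feasible p) : ∑ x, w x (σ x) ≤ total p := by
    have : total p = ∑ x, (p.1 x + p.2 (σ x)) := by
      simp only [total, Finset.sum_add_distrib, Equiv.sum_comp σ p.2]
    rw [this]
    exact Finset.sum_le_sum fun x _ => hp _ _ (hσ x)
  have hne : {p | feasible p}.Nonempty := by
    refine ⟨⟨fun x => ∑ y, |w x y|, fun _ => 0⟩, fun x y _ => ?_⟩
    have := Finset.single_le_sum (f := fun y => |w x y|) (fun y _ => abs_nonneg _)
      (Finset.mem_univ y)
    have := le_abs_self (w x y)
    simp only at *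
    linarith
  obtain ⟨p, hp, hmin⟩ := (measure fun p => (total p - ∑ x, w x (σ x)).toNat).wf.has_min _ hne
  refine ⟨p.1, p.2, hp, ?_⟩
  let tight (x : V) : Finset V := Finset.univ.filter fun y => R x y ∧ w x y = p.1 x + p.2 y
  by_cases hall : ∀ s : Finset V, s.card ≤ (s.biUnion tight).card
  · obtain ⟨f, hf, hft⟩ := (Finset.all_card_le_biUnion_card_iff_exists_injective tight).1 hall
    let π := Equiv.ofBijective f (Finite.injective_iff_bijective.1 hf)
    have hπ (x : V) : R x (π x) ∧ w x (π x) = p.1 x + p.2 (π x) := by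
      exact (Finset.mem_filter.1 (hft x)).2
    have := h π fun x => (hπ x).1
    rw [Finset.sum_congr rfl fun x _ => (hπ x).2, Finset.sum_add_distrib,
      Equiv.sum_comp π p.2] at this
    rwa [Finset.sum_add_distrib]
  · exfalso
    push Not at hall
    obtain ⟨s, hs⟩ := hall
    let q : (V → ℤ) × (V → ℤ) := ⟨fun x => p.1 x - if x ∈ s then 1 else 0,
      fun y => p.2 y + if y ∈ s.biUnion tight then 1 else 0⟩
    have hq : feasible q := by
      intro x y hxy
      have h₁ := hp x y hxy
      have h₂ : x ∈ s → w x y = p.1 x + p.2 y → y ∈ s.biUnion tight := fun hx ht =>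
        Finset.mem_biUnion.2 ⟨x, hx, by simp [tight, hxy, ht]⟩
      simp only [q]
      split_ifs with hx hy hy
      · linarith
      · have : w x y ≠ p.1 x + p.2 y := fun ht => hy (h₂ hx ht)
        omega
      · linarith
      · linarith
    have htotal : total q = total p - s.card + (s.biUnion tight).card := by
      simp only [total, q, Finset.sum_add_distrib, Finset.sum_sub_distrib, Finset.sum_boole,
        Finset.filter_univ_mem]
      ring
    have := bound q hq
    apply hmin q hq
    change (total q - _).toNat < (total p - _).toNat
    omega

/-- Strict preferences over the neighbors in a two-colored graph; being matched to oneself, i.e.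
being unmatched, is the worst option. -/
structure StrictPrefs (V : Type*) where
  adj : V → V → Prop
  rank : V → V → ℕ∞
  color : V → Bool
  symm : ∀ {x y}, adj x y → adj y x
  color_ne : ∀ {x y}, adj x y → color x ≠ color y
  rank_self : ∀ x, rank x x = ⊤
  rank_lt_top : ∀ {x y}, adj x y → rank x y < ⊤
  rank_inj : ∀ {x y z}, adj x y → adj x z → rank x y = rank x z → y = z

namespace StrictPrefs

variable {V : Type*} (Q : StrictPrefs V)

/-- `σ` maps every vertex to its partner in a matching, and every unmatched vertex to itself. -/
structure IsMate (σ : V → V) : Prop where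
  invol : ∀ x, σ (σ x) = x
  adj : ∀ x, σ x = x ∨ Q.adj x (σ x)

/-- The vote of `x` when comparing partner `y` to partner `z`. -/
noncomputable def vote (x y z : V) : ℤ :=
  if Q.rank x y < Q.rank x z then 1 else if Q.rank x z < Q.rank x y then -1 else 0

/-- `α` is a dual certificate for the popularity of `σ`. -/
structure IsWitness (σ : V → V) (α : V → ℤ) : Prop where
  mate : ∀ x, α (σ x) = -α x
  edge : ∀ {x y}, Q.adj x y → Q.vote x y (σ x) + Q.vote y x (σ y) ≤ α x + α y
  self : ∀ x, Q.vote x x (σ x) ≤ α x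

variable {Q} {σ σ' : V → V} {α : V → ℤ} {x y z : V}

theorem ne_of_adj (h : Q.adj x y) : x ≠ y := fun e => Q.color_ne h (e ▸ rfl)

theorem vote_self (x y : V) : Q.vote x y y = 0 := by simp [vote]

theorem vote_le_one : Q.vote x y z ≤ 1 := by unfold vote; split_ifs <;> simp

theorem neg_one_le_vote : -1 ≤ Q.vote x y z := by unfold vote; split_ifs <;> simp

theorem rank_lt_of_vote_eq_one (h : Q.vote x y z = 1) : Q.rank x y < Q.rank x z := by
  unfold vote at h
  split_ifs at h with h₁ h₂
  · exact h₁
  all_goals omega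

theorem vote_eq_one (h : Q.rank x y < Q.rank x z) : Q.vote x y z = 1 := if_pos h

theorem vote_eq_neg_one (h : Q.rank x z < Q.rank x y) : Q.vote x y z = -1 := by
  rw [vote, if_neg h.asymm, if_pos h]

theorem vote_mono {z' : V} (h : Q.rank x z ≤ Q.rank x z') : Q.vote x y z ≤ Q.vote x y z' := by
  by_cases h₁ : Q.rank x y < Q.rank x z
  · rw [vote_eq_one (h₁.trans_le h)]
    exact vote_le_one
  by_cases h₂ : Q.rank x z < Q.rank x y
  · rw [vote_eq_neg_one h₂]
    exact neg_one_le_vote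
  have h₃ : Q.vote x y z = 0 := by rw [vote, if_neg h₁, if_neg h₂]
  rw [h₃, vote, if_neg (not_lt.2 ((not_lt.1 h₂).trans h))]
  split_ifs <;> norm_num

theorem IsMate.rank_ne (hσ : Q.IsMate σ) (h : Q.adj x y) (hne : σ x ≠ y) :
    Q.rank x y ≠ Q.rank x (σ x) := by
  intro e
  rcases hσ.adj x with h' | h'
  · rw [h', Q.rank_self] at e
    exact (Q.rank_lt_top h).ne e
  · exact hne (Q.rank_inj h h' e).symm

theorem IsMate.vote_cases (hσ : Q.IsMate σ) (h : Q.adj x y) (hne : σ x ≠ y) :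
    Q.vote x y (σ x) = 1 ∧ Q.rank x y < Q.rank x (σ x) ∨
      Q.vote x y (σ x) = -1 ∧ Q.rank x (σ x) < Q.rank x y := by
  rcases (hσ.rank_ne h hne).lt_or_gt with h | h
  · exact .inl ⟨vote_eq_one h, h⟩
  · exact .inr ⟨vote_eq_neg_one h, h⟩

theorem IsMate.eq_comm (hσ : Q.IsMate σ) : σ x = y ↔ σ y = x :=
  ⟨fun h => h ▸ hσ.invol x, fun h => h ▸ hσ.invol y⟩

theorem IsMate.vote_self_of_ne (hσ : Q.IsMate σ) (h : σ x ≠ x) : Q.vote x x (σ x) = -1 := by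
  apply vote_eq_neg_one
  rw [Q.rank_self]
  exact Q.rank_lt_top ((hσ.adj x).resolve_left h)

theorem IsWitness.eq_zero (hα : Q.IsWitness σ α) (h : σ x = x) : α x = 0 := by
  have := hα.mate x
  rw [h] at this
  omega

theorem IsWitness.mem_Icc (hα : Q.IsWitness σ α) (x : V) :
    -1 ≤ α x ∧ α x ≤ 1 := by
  have h₁ := hα.self x
  have h₂ := hα.self (σ x)
  have h₃ := hα.mate x
  have h₄ := neg_one_le_vote (Q := Q) (x := x) (y := x) (z := σ x)
  have h₅ := neg_one_le_vote (Q := Q) (x := σ x) (y := σ x) (z := σ (σ x))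
  omega

theorem IsWitness.sum_eq_zero [Fintype V] (hσ : Q.IsMate σ) (hα : Q.IsWitness σ α) :
    ∑ x, α x = 0 := by
  have := Equiv.sum_comp (Function.Involutive.toPerm σ hσ.invol) α
  change ∑ x, α (σ x) = _ at this
  simp only [hα.mate, Finset.sum_neg_distrib] at this
  omega

theorem sum_add_sum_mate [Fintype V] (hσ : Q.IsMate σ) (f : V → ℤ) :
    ∑ x, (f x + f (σ x)) = 2 * ∑ x, f x := by
  have : ∑ x, f (σ x) = ∑ x, f x := Equiv.sum_comp (Function.Involutive.toPerm σ hσ.invol) f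
  rw [Finset.sum_add_distrib, this]
  ring

theorem IsWitness.pair_le (hα : Q.IsWitness σ α) (hσ' : Q.IsMate σ') (x : V) :
    Q.vote x (σ' x) (σ x) + Q.vote (σ' x) (σ' (σ' x)) (σ (σ' x)) ≤ α x + α (σ' x) := by
  rw [hσ'.invol]
  rcases hσ'.adj x with h | h
  · have := hα.self x
    simp only [h]
    omega
  · exact hα.edge h

theorem IsWitness.sum_vote_le [Fintype V] (hσ : Q.IsMate σ) (hα : Q.IsWitness σ α)
    (hσ' : Q.IsMate σ') : ∑ x, Q.vote x (σ' x) (σ x) ≤ 0 := by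
  have := Finset.sum_le_sum fun x (_ : x ∈ Finset.univ) => hα.pair_le hσ' x
  rw [sum_add_sum_mate hσ' fun x => Q.vote x (σ' x) (σ x), sum_add_sum_mate hσ',
    hα.sum_eq_zero hσ] at this
  omega

/-- If the certificate vanishes only at unmatched vertices, `σ` defeats every matching that
covers a vertex left unmatched by `σ`. -/
theorem IsWitness.sum_vote_lt [Fintype V] (hσ : Q.IsMate σ) (hα : Q.IsWitness σ α)
    (hne : ∀ x, α x = 0 → σ x = x) (hσ' : Q.IsMate σ') (hx : σ x = x) (hx' : σ' x ≠ x) :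
    ∑ x, Q.vote x (σ' x) (σ x) < 0 := by
  have hadj := (hσ'.adj x).resolve_left hx'
  have hlt : Q.vote x (σ' x) (σ x) + Q.vote (σ' x) (σ' (σ' x)) (σ (σ' x)) < α x + α (σ' x) := by
    refine lt_of_le_of_ne (hα.pair_le hσ' x) fun h => ?_
    rw [hσ'.invol, hα.eq_zero hx] at h
    have h₁ : σ x ≠ σ' x := by rw [hx]; exact hx'.symm
    have h₂ : σ (σ' x) ≠ x := fun e => h₁ (hσ.eq_comm.1 e)
    have h₃ := hα.mem_Icc (σ' x)
    have h₄ : Q.vote x (σ' x) (σ x) = 1 :=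
      vote_eq_one (by rw [hx, Q.rank_self]; exact Q.rank_lt_top hadj)
    rcases hσ.vote_cases (Q.symm hadj) h₂ with ⟨h₅, _⟩ | ⟨h₅, h₆⟩
    · omega
    · have := hne _ (by omega : α (σ' x) = 0)
      rw [this, Q.rank_self] at h₆
      exact not_top_lt h₆
  have := Finset.sum_lt_sum (fun x (_ : x ∈ Finset.univ) => hα.pair_le hσ' x)
    ⟨x, Finset.mem_univ x, hlt⟩
  rw [sum_add_sum_mate hσ' fun x => Q.vote x (σ' x) (σ x), sum_add_sum_mate hσ',
    hα.sum_eq_zero hσ] at this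
  omega

/-- Orient edges so that every vertex prefers the edges leaving it to the edges entering it, and
edges of the same kind according to their other endpoint. There is a stable set of oriented
edges. -/
theorem exists_stable_orientation [Finite V] (Ed : V → V → Prop)
    (hEd : ∀ x y, Ed x y → Q.adj x y) :
    ∃ S : V → V → Prop, (∀ x y, S x y → Ed x y) ∧ (∀ x y z, S x y → S x z → y = z) ∧
      (∀ x y z, S y x → S z x → y = z) ∧ (∀ x y z, S x y → ¬ S z x) ∧
      ∀ x y, Ed x y → S x y ∨ (∃ z, S x z ∧ Q.rank x z < Q.rank x y) ∨ (∃ z, S y z) ∨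
        ∃ z, S z y ∧ Q.rank y z < Q.rank y x := by
  let E := {p : V × V // Ed p.1 p.2}
  let beats (v : V) (e f : E) : Prop :=
    (e.1.1 = v ∧ f.1.1 = v ∧ Q.rank v e.1.2 < Q.rank v f.1.2) ∨ (e.1.1 = v ∧ f.1.2 = v) ∨
      (e.1.2 = v ∧ f.1.2 = v ∧ Q.rank v e.1.1 < Q.rank v f.1.1)
  let d (c : Bool) (e f : E) : Prop := ∃ v, Q.color v = c ∧ beats v e f
  have hne (e : E) : e.1.1 ≠ e.1.2 := ne_of_adj (hEd _ _ e.2)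
  have hcol (e : E) : Q.color e.1.1 ≠ Q.color e.1.2 := Q.color_ne (hEd _ _ e.2)
  have order (c : Bool) : IsStrictOrder E (d c) :=
    { irrefl := by
        rintro e ⟨v, -, h⟩
        rcases h with ⟨-, -, h⟩ | ⟨h, h'⟩ | ⟨-, -, h⟩
        · exact h.false
        · exact hne e (h.trans h'.symm)
        · exact h.false
      trans := by
        rintro e f g ⟨v, hv, h⟩ ⟨v', hv', h'⟩
        have hf := hcol f
        have hvv : v = v' := by
          rcases h with ⟨-, h, -⟩ | ⟨-, h⟩ | ⟨-, h, -⟩ <;>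
          rcases h' with ⟨h', -, -⟩ | ⟨h', -⟩ | ⟨h', -, -⟩ <;>
          first
          | exact h.symm.trans h'
          | (rw [h, h', hv, hv'] at hf; exact absurd rfl hf)
        subst hvv
        have hf := hne f
        refine ⟨v, hv, ?_⟩
        rcases h with ⟨h₁, h₂, h₃⟩ | ⟨h₁, h₂⟩ | ⟨h₁, h₂, h₃⟩ <;>
          rcases h' with ⟨h₁', h₂', h₃'⟩ | ⟨h₁', h₂'⟩ | ⟨h₁', h₂', h₃'⟩
        · exact .inl ⟨h₁, h₂', h₃.trans h₃'⟩
        · exact .inr (.inl ⟨h₁, h₂'⟩)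
        · exact absurd (h₂.trans h₁'.symm) hf
        · exact absurd (h₁'.trans h₂.symm) hf
        · exact absurd (h₁'.trans h₂.symm) hf
        · exact .inr (.inl ⟨h₁, h₂'⟩)
        · exact absurd (h₁'.trans h₂.symm) hf
        · exact absurd (h₁'.trans h₂.symm) hf
        · exact .inr (.inr ⟨h₁, h₂', h₃.trans h₃'⟩) }
  obtain ⟨S, hS, hS'⟩ := exists_stable_set (d true) (d false)
  have indep (v : V) (e f : E) (he : e ∈ S) (hf : f ∈ S) : ¬ beats v e f := fun h => by
    cases hc : Q.color v
    · exact (hS e he f hf).2 ⟨v, hc, h⟩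
    · exact (hS e he f hf).1 ⟨v, hc, h⟩
  refine ⟨fun x y => ∃ h : Ed x y, (⟨(x, y), h⟩ : E) ∈ S, fun x y h => h.1, ?_, ?_, ?_, ?_⟩
  · rintro x y z ⟨h₁, h₂⟩ ⟨h₁', h₂'⟩
    by_contra hyz
    rcases lt_trichotomy (Q.rank x y) (Q.rank x z) with h | h | h
    · exact indep x _ _ h₂ h₂' (.inl ⟨rfl, rfl, h⟩)
    · exact hyz (Q.rank_inj (hEd _ _ h₁) (hEd _ _ h₁') h)
    · exact indep x _ _ h₂' h₂ (.inl ⟨rfl, rfl, h⟩)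
  · rintro x y z ⟨h₁, h₂⟩ ⟨h₁', h₂'⟩
    by_contra hyz
    rcases lt_trichotomy (Q.rank x y) (Q.rank x z) with h | h | h
    · exact indep x _ _ h₂ h₂' (.inr (.inr ⟨rfl, rfl, h⟩))
    · exact hyz (Q.rank_inj (Q.symm (hEd _ _ h₁)) (Q.symm (hEd _ _ h₁')) h)
    · exact indep x _ _ h₂' h₂ (.inr (.inr ⟨rfl, rfl, h⟩))
  · rintro x y z ⟨h₁, h₂⟩ ⟨h₁', h₂'⟩
    exact indep x _ _ h₂ h₂' (.inr (.inl ⟨rfl, rfl⟩))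
  · intro x y hxy
    have key (f : E) (hf : f ∈ S) (v : V) (h : beats v f ⟨(x, y), hxy⟩) :
        (∃ z, (∃ h : Ed x z, (⟨(x, z), h⟩ : E) ∈ S) ∧ Q.rank x z < Q.rank x y) ∨
        (∃ z, ∃ h : Ed y z, (⟨(y, z), h⟩ : E) ∈ S) ∨
        ∃ z, (∃ h : Ed z y, (⟨(z, y), h⟩ : E) ∈ S) ∧ Q.rank y z < Q.rank y x := by
      obtain ⟨⟨p, q⟩, hpq⟩ := f
      rcases h with ⟨rfl, h₂, h₃⟩ | ⟨rfl, h₂⟩ | ⟨rfl, h₂, h₃⟩ <;> dsimp only at h₂ <;> subst h₂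
      · exact .inl ⟨q, ⟨hpq, hf⟩, h₃⟩
      · exact .inr (.inl ⟨q, hpq, hf⟩)
      · exact .inr (.inr ⟨p, ⟨hpq, hf⟩, h₃⟩)
    rcases hS' ⟨(x, y), hxy⟩ with h | ⟨f, hf, v, -, h⟩ | ⟨f, hf, v, -, h⟩
    · exact .inl ⟨hxy, h⟩
    · exact .inr (key f hf v h)
    · exact .inr (key f hf v h)

/-- A popular matching `σ` with certificate `α` can be modified on the zero set of `α` so that the
new certificate vanishes only at unmatched vertices. -/
theorem IsWitness.exists_zero_imp_unmatched [Finite V] (hσ : Q.IsMate σ)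
    (hα : Q.IsWitness σ α) :
    ∃ τ β, Q.IsMate τ ∧ Q.IsWitness τ β ∧ (∀ x, β x = 0 → τ x = x) ∧
      ∀ x, α x ≠ 0 → τ x = σ x := by
  have hα₀ (x : V) : α (σ x) = 0 ↔ α x = 0 := by rw [hα.mate]; omega
  obtain ⟨S, hSE, hSout, hSin, hSmix, hSdom⟩ := Q.exists_stable_orientation
    (fun x y => Q.adj x y ∧ α x = 0 ∧ α y = 0 ∧ Q.rank y x ≤ Q.rank y (σ y)) fun x y h => h.1
  have unmatched (x : V) (h₀ : α x = 0) (h₁ : ∀ y, ¬ S x y) (h₂ : ∀ y, ¬ S y x) : σ x = x := by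
    by_contra hx
    have hadj := (hσ.adj x).resolve_left hx
    rcases hSdom (σ x) x ⟨Q.symm hadj, (hα₀ x).2 h₀, h₀, le_rfl⟩ with
      h | ⟨z, hz, hlt⟩ | ⟨z, hz⟩ | ⟨z, hz, -⟩
    · exact h₂ _ h
    · obtain ⟨hadj', h₃, h₄, hle⟩ := hSE _ _ hz
      have hzx : z ≠ x := fun e => by simp [e] at hlt
      have hne : σ z ≠ σ x := fun e => hzx (by rw [← hσ.invol z, e, hσ.invol])
      have := hα.edge hadj'
      rw [vote_eq_one (by rwa [hσ.invol]),
        vote_eq_one (lt_of_le_of_ne hle (hσ.rank_ne (Q.symm hadj') hne))] at this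
      omega
    · exact h₁ _ hz
    · exact h₂ _ hz
  have hex (x : V) : ∃ q : V × ℤ, (α x ≠ 0 ∧ q = (σ x, α x)) ∨
      (α x = 0 ∧ (∃ y, S x y ∧ q = (y, 1))) ∨ (α x = 0 ∧ (∃ y, S y x ∧ q = (y, -1))) ∨
      (α x = 0 ∧ (∀ y, ¬ S x y) ∧ (∀ y, ¬ S y x) ∧ q = (x, 0)) := by
    by_cases h₀ : α x = 0
    · by_cases h₁ : ∃ y, S x y
      · exact ⟨_, .inr (.inl ⟨h₀, h₁.choose, h₁.choose_spec, rfl⟩)⟩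
      by_cases h₂ : ∃ y, S y x
      · exact ⟨_, .inr (.inr (.inl ⟨h₀, h₂.choose, h₂.choose_spec, rfl⟩))⟩
      push Not at h₁ h₂
      exact ⟨_, .inr (.inr (.inr ⟨h₀, h₁, h₂, rfl⟩))⟩
    · exact ⟨_, .inl ⟨h₀, rfl⟩⟩
  choose f hf using hex
  have f_of_ne {x : V} (h : α x ≠ 0) : f x = (σ x, α x) := by
    rcases hf x with h' | h' | h' | h'
    · exact h'.2
    all_goals exact absurd h'.1 h
  have f_out {x y : V} (h : S x y) : f x = (y, 1) := by
    have h₀ := (hSE _ _ h).2.1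
    rcases hf x with h' | ⟨-, z, hz, h'⟩ | ⟨-, z, hz, h'⟩ | h'
    · exact absurd h₀ h'.1
    · rw [hSout _ _ _ h hz, h']
    · exact absurd hz (hSmix _ _ _ h)
    · exact absurd h (h'.2.1 _)
  have f_in {x y : V} (h : S y x) : f x = (y, -1) := by
    have h₀ := (hSE _ _ h).2.2.1
    rcases hf x with h' | ⟨-, z, hz, h'⟩ | ⟨-, z, hz, h'⟩ | h'
    · exact absurd h₀ h'.1
    · exact absurd h (hSmix _ _ _ hz)
    · rw [hSin _ _ _ h hz, h']
    · exact absurd h (h'.2.2.1 _)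
  have hτ : Q.IsMate fun x => (f x).1 := by
    constructor
    · intro x
      rcases hf x with ⟨h₀, h⟩ | ⟨-, y, hy, h⟩ | ⟨-, y, hy, h⟩ | ⟨-, -, -, h⟩
      · simp only [h]
        rw [f_of_ne (by rwa [Ne, hα₀]), hσ.invol]
      · simp only [h, f_in hy]
      · simp only [h, f_out hy]
      · simp only [h]
    · intro x
      rcases hf x with ⟨h₀, h⟩ | ⟨-, y, hy, h⟩ | ⟨-, y, hy, h⟩ | ⟨-, -, -, h⟩ <;> simp only [h]
      · exact hσ.adj x
      · exact .inr (hSE _ _ hy).1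
      · exact .inr (Q.symm (hSE _ _ hy).1)
      · exact .inl trivial
  have cross {x y : V} (hadj : Q.adj x y) (hx : α x = 0) (hy : α y ≠ 0) :
      Q.vote x y (f x).1 + Q.vote y x (f y).1 ≤ (f x).2 + (f y).2 := by
    have hxy : σ x ≠ y := fun e => hy (by rw [← e, hα₀, hx])
    have hyx : σ y ≠ x := fun e => hxy (hσ.eq_comm.1 e)
    have hold := hα.edge hadj
    have hI := hα.mem_Icc y
    rw [f_of_ne hy]
    have hv : Q.vote x y (f x).1 ≤ 1 := vote_le_one
    rcases hf x with ⟨h₀, -⟩ | ⟨-, z, hz, h⟩ | ⟨-, z, hz, h⟩ | ⟨-, h₁, h₂, h⟩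
    · exact absurd hx h₀
    · rcases hσ.vote_cases hadj hxy with ⟨h₁, -⟩ | ⟨h₁, -⟩ <;>
      rcases hσ.vote_cases (Q.symm hadj) hyx with ⟨h₂, -⟩ | ⟨h₂, -⟩ <;>
      rw [h] at hv ⊢ <;> dsimp only at hv ⊢ <;> omega
    · have : Q.vote x y z ≤ Q.vote x y (σ x) := vote_mono (hSE _ _ hz).2.2.2
      rcases hσ.vote_cases hadj hxy with ⟨h₁, -⟩ | ⟨h₁, -⟩ <;>
      rcases hσ.vote_cases (Q.symm hadj) hyx with ⟨h₂, -⟩ | ⟨h₂, -⟩ <;>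
      rw [h] <;> dsimp only <;> omega
    · have hx' := unmatched x hx h₁ h₂
      rw [hx'] at hold
      rw [h]
      dsimp only
      omega
  have sink {x x' y y' : V} (hadj : Q.adj x y) (hx : S x' x) (hy : S y' y) :
      Q.rank x x' < Q.rank x y := by
    have hle := (hSE _ _ hx).2.2.2
    have hne : x' ≠ y := fun e => hSmix _ _ _ (e ▸ hx) hy
    by_contra hlt
    have hlt' : Q.rank x y < Q.rank x x' := lt_of_le_of_ne (not_lt.1 hlt) fun e =>
      hne (Q.rank_inj hadj (Q.symm (hSE _ _ hx).1) e).symm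
    rcases hSdom y x ⟨Q.symm hadj, (hSE _ _ hy).2.2.1, (hSE _ _ hx).2.2.1, hlt'.le.trans hle⟩ with
      h | ⟨z, hz, -⟩ | ⟨z, hz⟩ | ⟨z, hz, h⟩
    · exact hSmix _ _ _ h hy
    · exact hSmix _ _ _ hz hy
    · exact hSmix _ _ _ hz hx
    · rw [hSin _ _ _ hz hx] at h
      exact hlt h
  have mixed {x x' y y' : V} (hadj : Q.adj x y) (hx : S x x') (hy : S y' y) :
      Q.vote x y x' + Q.vote y x y' ≤ 0 := by
    by_cases he : x' = y
    · subst he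
      rw [hSin _ _ _ hy hx, vote_self, vote_self]
      rfl
    have hne : y' ≠ x := fun e => he (hSout _ _ _ hx (e ▸ hy))
    have h₁ := hτ.vote_cases hadj (by simpa only [f_out hx] using he)
    have h₂ := hτ.vote_cases (Q.symm hadj) (by simpa only [f_in hy] using hne)
    simp only [f_out hx] at h₁
    simp only [f_in hy] at h₂
    rcases h₁ with ⟨h₁, hr₁⟩ | ⟨h₁, -⟩ <;> rcases h₂ with ⟨h₂, hr₂⟩ | ⟨h₂, -⟩ <;> try omega
    exfalso
    rcases hSdom x y ⟨hadj, (hSE _ _ hx).2.1, (hSE _ _ hy).2.2.1,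
      hr₂.le.trans (hSE _ _ hy).2.2.2⟩ with h | ⟨z, hz, h⟩ | ⟨z, hz⟩ | ⟨z, hz, h⟩
    · exact he (hSout _ _ _ hx h)
    · rw [hSout _ _ _ hz hx] at h
      exact h.asymm hr₁
    · exact hSmix _ _ _ hz hy
    · rw [hSin _ _ _ hz hy] at h
      exact h.asymm hr₂
  have free {x y : V} (hadj : Q.adj x y) (hx : α x = 0) (hy : α y = 0) (h₁ : ∀ z, ¬ S x z)
      (h₂ : ∀ z, ¬ S z x) : Q.vote y x (f y).1 = -1 ∧ (f y).2 = 1 := by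
    rcases hSdom y x ⟨Q.symm hadj, hy, hx, by
        rw [unmatched x hx h₁ h₂, Q.rank_self]; exact le_top⟩ with
      h | ⟨z, hz, h⟩ | ⟨z, hz⟩ | ⟨z, hz, -⟩
    · exact absurd h (h₂ _)
    · rw [f_out hz]
      exact ⟨vote_eq_neg_one h, rfl⟩
    · exact absurd hz (h₁ _)
    · exact absurd hz (h₂ _)
  refine ⟨fun x => (f x).1, fun x => (f x).2, hτ, ⟨?_, ?_, ?_⟩, ?_, ?_⟩
  · intro x
    rcases hf x with ⟨h₀, h⟩ | ⟨-, y, hy, h⟩ | ⟨-, y, hy, h⟩ | ⟨-, -, -, h⟩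
    · simp only [h]
      rw [f_of_ne (by rwa [Ne, hα₀]), hα.mate]
    · simp only [h, f_in hy]
    · simp only [h, f_out hy, neg_neg]
    · simp only [h, neg_zero]
  · intro x y hadj
    by_cases hx : α x = 0
    swap
    · by_cases hy : α y = 0
      · have := cross (Q.symm hadj) hy hx
        omega
      · rw [f_of_ne hx, f_of_ne hy]
        exact hα.edge hadj
    by_cases hy : α y = 0
    swap
    · exact cross hadj hx hy
    have hv₁ : Q.vote x y (f x).1 ≤ 1 := vote_le_one
    have hv₂ : Q.vote y x (f y).1 ≤ 1 := vote_le_one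
    rcases hf x with ⟨h₀, -⟩ | ⟨-, x', hx', h⟩ | ⟨-, x', hx', h⟩ | ⟨-, h₁, h₂, h⟩
    · exact absurd hx h₀
    · rcases hf y with ⟨h₀, -⟩ | ⟨-, y', hy', h'⟩ | ⟨-, y', hy', h'⟩ | ⟨-, h₁', h₂', h'⟩
      · exact absurd hy h₀
      · have e : (f x).2 = 1 := by rw [h]
        have e' : (f y).2 = 1 := by rw [h']
        omega
      · rw [h, h']
        exact mixed hadj hx' hy'
      · have := free (Q.symm hadj) hy hx h₁' h₂'
        have e : (f y).2 = 0 := by rw [h']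
        omega
    · rcases hf y with ⟨h₀, -⟩ | ⟨-, y', hy', h'⟩ | ⟨-, y', hy', h'⟩ | ⟨-, h₁', h₂', h'⟩
      · exact absurd hy h₀
      · have := mixed (Q.symm hadj) hy' hx'
        rw [h, h', add_comm]
        exact this
      · rw [h, h']
        dsimp only
        rw [vote_eq_neg_one (sink hadj hx' hy'), vote_eq_neg_one (sink (Q.symm hadj) hy' hx')]
      · have := free (Q.symm hadj) hy hx h₁' h₂'
        have e : (f y).2 = 0 := by rw [h']
        omega
    · have := free hadj hx hy h₁ h₂
      have e : (f x).2 = 0 := by rw [h]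
      omega
  · intro x
    rcases hf x with ⟨h₀, h⟩ | ⟨-, y, hy, h⟩ | ⟨-, y, hy, h⟩ | ⟨-, -, -, h⟩ <;> simp only [h]
    · exact hα.self x
    · exact vote_le_one
    · have := hτ.vote_self_of_ne (x := x) (by
        simp only [h]; exact ne_of_adj (hSE _ _ hy).1)
      simp only [h] at this
      exact this.le
    · exact (vote_self _ _).le
  · intro x hx
    rcases hf x with ⟨h₀, h⟩ | ⟨-, y, hy, h⟩ | ⟨-, y, hy, h⟩ | ⟨-, -, -, h⟩ <;>
      simp only [h] at hx ⊢
    · exact absurd hx h₀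
    · exact absurd hx (by norm_num)
    · exact absurd hx (by norm_num)
  · intro x hx
    simp only [f_of_ne hx]

end StrictPrefs

namespace PrefSys

variable {A B : Type} (P : PrefSys A B)

/-- The preferences of both sides, as preferences on the disjoint union `A ⊕ B`. -/
def toStrictPrefs : StrictPrefs (A ⊕ B) where
  adj
    | .inl a, .inr b => P.adj a b
    | .inr b, .inl a => P.adj a b
    | _, _ => False
  rank
    | .inl a, .inr b => P.rankA a b
    | .inr b, .inl a => P.rankB b a
    | _, _ => ⊤
  color := Sum.isLeft
  symm := by rintro (a | b) (a' | b') h <;> exact h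
  color_ne := by rintro (a | b) (a' | b') h <;> simp_all
  rank_self := by rintro (a | b) <;> rfl
  rank_lt_top := by rintro (a | b) (a' | b') h <;> simp_all
  rank_inj := by
    rintro (a | b) (a' | b') (a'' | b'') h h' e
    all_goals first | exact h.elim | exact h'.elim | skip
    · exact congrArg _ (P.rankA_inj a b' b'' h h' (by simpa using e))
    · exact congrArg _ (P.rankB_inj b a' a'' h h' (by simpa using e))

variable {P}

/-- `σ` is the partner function of `M`. -/
structure Represents (P : PrefSys A B) (σ : A ⊕ B → A ⊕ B) (M : Finset (A × B)) : Prop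
    extends P.toStrictPrefs.IsMate σ where
  mem_iff : ∀ a b, (a, b) ∈ M ↔ σ (.inl a) = .inr b

variable {M N : Finset (A × B)} {σ τ : A ⊕ B → A ⊕ B}

theorem Represents.mem_iff' (h : P.Represents σ M) (a : A) (b : B) :
    (a, b) ∈ M ↔ σ (.inr b) = .inl a := by
  rw [h.mem_iff, h.toIsMate.eq_comm]

theorem Represents.isMatching (h : P.Represents σ M) : P.IsMatching M := by
  refine ⟨?_, ?_, ?_⟩
  · rintro ⟨a, b⟩ hp
    rw [h.mem_iff] at hp
    rcases h.adj (.inl a) with h' | h' <;> rw [hp] at h'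
    · cases h'
    · exact h'
  · rintro ⟨a, b⟩ hp ⟨a', b'⟩ hq e
    dsimp only at e
    subst e
    rw [h.mem_iff] at hp hq
    rw [Sum.inr.inj (hp.symm.trans hq)]
  · rintro ⟨a, b⟩ hp ⟨a', b'⟩ hq e
    dsimp only at e
    subst e
    rw [h.mem_iff'] at hp hq
    rw [Sum.inl.inj (hp.symm.trans hq)]

theorem IsMatching.exists_represents (hM : P.IsMatching M) : ∃ σ, P.Represents σ M := by
  obtain ⟨h₁, h₂, h₃⟩ := hM
  have hex (x : A ⊕ B) : ∃ y : A ⊕ B, (∃ a b, (a, b) ∈ M ∧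
      (x = .inl a ∧ y = .inr b ∨ x = .inr b ∧ y = .inl a)) ∨
      (y = x ∧ ∀ a b, (a, b) ∈ M → x ≠ .inl a ∧ x ≠ .inr b) := by
    by_cases h : ∃ a b, (a, b) ∈ M ∧ (x = .inl a ∨ x = .inr b)
    · obtain ⟨a, b, hab, h | h⟩ := h
      · exact ⟨.inr b, .inl ⟨a, b, hab, .inl ⟨h, rfl⟩⟩⟩
      · exact ⟨.inl a, .inl ⟨a, b, hab, .inr ⟨h, rfl⟩⟩⟩
    · push Not at h
      exact ⟨x, .inr ⟨rfl, h⟩⟩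
  choose σ hσ using hex
  have left {a b} (h : (a, b) ∈ M) : σ (.inl a) = .inr b := by
    rcases hσ (.inl a) with ⟨a', b', h', ⟨e, e'⟩ | ⟨e, -⟩⟩ | ⟨-, h'⟩
    · cases e
      cases h₂ _ h _ h' rfl
      exact e'
    · cases e
    · exact absurd rfl (h' a b h).1
  have right {a b} (h : (a, b) ∈ M) : σ (.inr b) = .inl a := by
    rcases hσ (.inr b) with ⟨a', b', h', ⟨e, -⟩ | ⟨e, e'⟩⟩ | ⟨-, h'⟩
    · cases e
    · cases e
      cases h₃ _ h _ h' rfl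
      exact e'
    · exact absurd rfl (h' a b h).2
  refine ⟨σ, ⟨fun x => ?_, fun x => ?_⟩, fun a b => ⟨left, fun h => ?_⟩⟩
  · rcases hσ x with ⟨a, b, h, ⟨rfl, e⟩ | ⟨rfl, e⟩⟩ | ⟨h, -⟩
    · rw [e, right h]
    · rw [e, left h]
    · rw [h, h]
  · rcases hσ x with ⟨a, b, h, ⟨rfl, e⟩ | ⟨rfl, e⟩⟩ | ⟨h, -⟩
    · rw [e]
      exact .inr (h₁ _ h)
    · rw [e]
      exact .inr (h₁ _ h)
    · exact .inl h
  · rcases hσ (.inl a) with ⟨a', b', h', ⟨e, e'⟩ | ⟨e, -⟩⟩ | ⟨h', -⟩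
    · cases e
      rw [h] at e'
      cases e'
      exact h'
    · cases e
    · rw [h] at h'
      cases h'

theorem exists_represents_of_isMate [Fintype A] [Fintype B] (h : P.toStrictPrefs.IsMate σ) :
    ∃ M, P.Represents σ M :=
  ⟨Finset.univ.filter fun p => σ (.inl p.1) = .inr p.2, h, by simp⟩

theorem Represents.voteAplus_iff (h : P.Represents σ M) (a : A) (b : B) :
    P.voteAplus M a b ↔ P.toStrictPrefs.rank (.inl a) (.inr b) <
      P.toStrictPrefs.rank (.inl a) (σ (.inl a)) := by
  simp only [voteAplus, h.mem_iff]
  rcases hx : σ (.inl a) with a' | b' <;> simp [toStrictPrefs]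

theorem Represents.voteBplus_iff (h : P.Represents σ M) (a : A) (b : B) :
    P.voteBplus M a b ↔ P.toStrictPrefs.rank (.inr b) (.inl a) <
      P.toStrictPrefs.rank (.inr b) (σ (.inr b)) := by
  simp only [voteBplus, h.mem_iff']
  rcases hx : σ (.inr b) with a' | b' <;> simp [toStrictPrefs]

theorem Represents.blocking_iff (h : P.Represents σ M) (a : A) (b : B) :
    P.Blocking M a b ↔ P.adj a b ∧
      P.toStrictPrefs.rank (.inl a) (.inr b) < P.toStrictPrefs.rank (.inl a) (σ (.inl a)) ∧
      P.toStrictPrefs.rank (.inr b) (.inl a) < P.toStrictPrefs.rank (.inr b) (σ (.inr b)) := by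
  rw [← h.voteAplus_iff, ← h.voteBplus_iff]
  exact ⟨fun h => ⟨h.1, h.2.2⟩, fun h => ⟨h.1, fun hm => (h.2.1 b hm).false, h.2⟩⟩

theorem Represents.prefA_iff (hM : P.Represents σ M) (hN : P.Represents τ N) (a : A) :
    P.prefA M N a ↔ P.toStrictPrefs.rank (.inl a) (σ (.inl a)) <
      P.toStrictPrefs.rank (.inl a) (τ (.inl a)) := by
  rw [prefA]
  change (∃ b, _ ∧ P.voteAplus N a b) ↔ _
  simp only [hM.mem_iff, hN.voteAplus_iff]
  rcases hx : σ (.inl a) with a' | b' <;> simp [toStrictPrefs]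

theorem Represents.prefB_iff (hM : P.Represents σ M) (hN : P.Represents τ N) (b : B) :
    P.prefB M N b ↔ P.toStrictPrefs.rank (.inr b) (σ (.inr b)) <
      P.toStrictPrefs.rank (.inr b) (τ (.inr b)) := by
  rw [prefB]
  change (∃ a, _ ∧ P.voteBplus N a b) ↔ _
  simp only [hM.mem_iff', hN.voteBplus_iff]
  rcases hx : σ (.inr b) with a' | b' <;> simp [toStrictPrefs]

theorem Represents.phi_sub_phi [Fintype A] [Fintype B] (hM : P.Represents σ M)
    (hN : P.Represents τ N) :
    (P.phi M N : ℤ) - P.phi N M = ∑ x, P.toStrictPrefs.vote x (σ x) (τ x) := by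
  have vote_eq (x y z : A ⊕ B) : P.toStrictPrefs.vote x y z =
      (if P.toStrictPrefs.rank x y < P.toStrictPrefs.rank x z then 1 else 0) -
      (if P.toStrictPrefs.rank x z < P.toStrictPrefs.rank x y then 1 else 0) := by
    unfold StrictPrefs.vote
    split_ifs with h₁ h₂ <;> first | rfl | exact absurd h₂ h₁.asymm
  have phi_eq {M N σ τ} (hM : P.Represents σ M) (hN : P.Represents τ N) : (P.phi M N : ℤ) =
      ∑ x, if P.toStrictPrefs.rank x (σ x) < P.toStrictPrefs.rank x (τ x) then 1 else 0 := by
    rw [phi, Fintype.sum_sum_type, Finset.sum_boole, Finset.sum_boole]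
    simp only [hM.prefA_iff hN, hM.prefB_iff hN, Nat.card_eq_fintype_card, Fintype.card_subtype]
    push_cast
    rfl
  simp only [vote_eq, Finset.sum_sub_distrib, phi_eq hM hN, phi_eq hN hM]

/-- A popular matching has a dual certificate. -/
theorem Popular.exists_isWitness [Fintype A] [Fintype B] (hM : P.Popular M)
    (hσ : P.Represents σ M) : ∃ α, P.toStrictPrefs.IsWitness σ α := by
  set Q := P.toStrictPrefs with hQ
  let R : A ⊕ B → A ⊕ B → Prop
    | .inl a, .inr b => P.adj a b
    | .inr _, .inl _ => True
    | x, y => x = y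
  let w : A ⊕ B → A ⊕ B → ℤ
    | .inl a, .inr b => Q.vote (.inl a) (.inr b) (σ (.inl a)) +
        Q.vote (.inr b) (.inl a) (σ (.inr b))
    | .inr _, .inl _ => 0
    | x, _ => Q.vote x x (σ x)
  have R_of {x y : A ⊕ B} (h : y = x ∨ Q.adj x y) : R x y := by
    rcases h with rfl | h
    · rcases y with a | b <;> rfl
    · rcases x with a | b <;> rcases y with a' | b' <;> first | exact h | exact h.elim | trivial
  obtain ⟨u, v, huv, hsum⟩ := exists_dual_of_assignment_nonpos R w
    (Function.Involutive.toPerm σ hσ.invol) (fun x => R_of (hσ.adj x)) (by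
    intro π hπ
    let τ : A ⊕ B → A ⊕ B
      | .inl a => π (.inl a)
      | .inr b => π.symm (.inr b)
    have hl (a : A) : π (.inl a) = .inl a ∨ ∃ b, π (.inl a) = .inr b ∧ P.adj a b := by
      have := hπ (.inl a)
      rcases h : π (.inl a) with a' | b <;> rw [h] at this
      · exact .inl this.symm
      · exact .inr ⟨b, rfl, this⟩
    have hr (b : B) : π.symm (.inr b) = .inr b ∨ ∃ a, π.symm (.inr b) = .inl a ∧ P.adj a b := by
      have := hπ (π.symm (.inr b))
      rw [π.apply_symm_apply] at this
      rcases h : π.symm (.inr b) with a | b' <;> rw [h] at this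
      · exact .inr ⟨a, rfl, this⟩
      · exact .inl this
    have hτ : Q.IsMate τ := by
      constructor
      · rintro (a | b)
        · rcases hl a with h | ⟨b, h, -⟩
          · simp only [τ, h]
          · have e : τ (.inl a) = .inr b := h
            rw [e]
            exact π.symm_apply_eq.2 h.symm
        · rcases hr b with h | ⟨a, h, -⟩
          · simp only [τ, h]
          · have e : τ (.inr b) = .inl a := h
            rw [e]
            exact (π.symm_apply_eq.1 h).symm
      · rintro (a | b)
        · rcases hl a with h | ⟨b, h, h'⟩ <;> simp only [τ, h]
          · exact .inl trivial
          · exact .inr h'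
        · rcases hr b with h | ⟨a, h, h'⟩ <;> simp only [τ, h]
          · exact .inl trivial
          · exact .inr h'
    obtain ⟨N, hN⟩ := exists_represents_of_isMate hτ
    have hpop := hM.2 N hN.isMatching
    have hphi := hN.phi_sub_phi hσ
    rw [← hQ] at hphi
    let l : A ⊕ B → ℤ
      | .inl a => Q.vote (.inl a) (τ (.inl a)) (σ (.inl a))
      | .inr _ => 0
    let r : A ⊕ B → ℤ
      | .inl _ => 0
      | .inr b => Q.vote (.inr b) (τ (.inr b)) (σ (.inr b))
    have hw (x : A ⊕ B) : w x (π x) = l x + r (π x) := by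
      have hx := hπ x
      have hs := π.symm_apply_apply x
      rcases x with a | b
      · rcases h : π (.inl a) with a' | b <;> rw [h] at hx hs
        · cases hx
          simp [w, l, r, τ, h]
        · simp [w, l, r, τ, h, hs]
      · rcases h : π (.inr b) with a' | b' <;> rw [h] at hx hs
        · simp [w, l, r]
        · cases hx
          simp [w, l, r, τ, hs]
    have : ∑ x, w x (π x) = ∑ x, Q.vote x (τ x) (σ x) := by
      rw [Finset.sum_congr rfl fun x _ => hw x, Finset.sum_add_distrib, Equiv.sum_comp π r]
      simp [Fintype.sum_sum_type, l, r]
    omega)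
  have hedge (a : A) (b : B) (h : P.adj a b) :
      Q.vote (.inl a) (.inr b) (σ (.inl a)) + Q.vote (.inr b) (.inl a) (σ (.inr b)) ≤
        (u (.inl a) + v (.inl a)) + (u (.inr b) + v (.inr b)) := by
    have h₁ : w (.inl a) (.inr b) ≤ _ := huv (.inl a) (.inr b) h
    have h₂ : w (.inr b) (.inl a) ≤ _ := huv (.inr b) (.inl a) trivial
    simp only [w] at h₁ h₂
    omega
  have hadj {x y : A ⊕ B} (h : Q.adj x y) :
      Q.vote x y (σ x) + Q.vote y x (σ y) ≤ (u x + v x) + (u y + v y) := by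
    rcases x with a | b <;> rcases y with a' | b' <;> first | exact h.elim | skip
    · exact hedge a b' h
    · have := hedge a' b h
      omega
  have hself (x : A ⊕ B) : Q.vote x x (σ x) ≤ u x + v x := by
    rcases x with a | b <;> exact huv _ _ rfl
  refine ⟨fun x => u x + v x, fun x => ?_, hadj, hself⟩
  have hpair (x : A ⊕ B) : 0 ≤ (u x + v x) + (u (σ x) + v (σ x)) := by
    rcases hσ.adj x with h | h
    · have := hself x
      rw [h, StrictPrefs.vote_self] at this
      rw [h]
      omega
    · have := hadj h
      rwa [StrictPrefs.vote_self, hσ.invol, StrictPrefs.vote_self, add_zero] at this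
  have htotal := StrictPrefs.sum_add_sum_mate hσ.toIsMate fun x => u x + v x
  have hzero := (Finset.sum_eq_zero_iff_of_nonneg fun x _ => hpair x).1
    (le_antisymm (by omega) (Finset.sum_nonneg fun x _ => hpair x)) x (Finset.mem_univ x)
  omega

theorem Represents.popular [Fintype A] [Fintype B] (hσ : P.Represents σ M) {α : A ⊕ B → ℤ}
    (hα : P.toStrictPrefs.IsWitness σ α) : P.Popular M := by
  refine ⟨hσ.isMatching, fun N hN => ?_⟩
  obtain ⟨τ, hτ⟩ := hN.exists_represents
  have h₁ := hτ.phi_sub_phi hσ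
  have h₂ := hα.sum_vote_le hσ.toIsMate hτ.toIsMate
  omega

theorem Represents.dominant [Fintype A] [Fintype B] (hσ : P.Represents σ M) {α : A ⊕ B → ℤ}
    (hα : P.toStrictPrefs.IsWitness σ α) (hne : ∀ x, α x = 0 → σ x = x) : P.Dominant M := by
  refine ⟨hσ.popular hα, fun N hN hcard => ?_⟩
  obtain ⟨τ, hτ⟩ := hN.exists_represents
  have card_image {M} (hM : P.IsMatching M) : (M.image Prod.fst).card = M.card :=
    Finset.card_image_of_injOn fun p hp q hq => hM.2.1 p hp q hq
  rw [← card_image hN, ← card_image hσ.isMatching] at hcard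
  obtain ⟨a, haN, haM⟩ := Finset.exists_mem_notMem_of_card_lt_card hcard
  obtain ⟨⟨a, b⟩, hab, rfl⟩ := Finset.mem_image.1 haN
  have hτa : τ (.inl a) ≠ .inl a := by
    rw [(hτ.mem_iff a b).1 hab]
    exact Sum.inr_ne_inl
  have hσa : σ (.inl a) = .inl a := by
    rcases hσ.adj (.inl a) with h | h
    · exact h
    · rcases hx : σ (.inl a) with a' | b'
      · rw [hx] at h
        exact h.elim
      · exact absurd (Finset.mem_image.2 ⟨(a, b'), (hσ.mem_iff a b').2 hx, rfl⟩) haM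
  have h₁ := hτ.phi_sub_phi hσ
  have h₂ := hα.sum_vote_lt hσ.toIsMate hne hτ.toIsMate hσa hτa
  omega

end PrefSys

/-- If `G` admits an unstable popular matching then `G` admits an
unstable dominant matching. -/
theorem unstable_popular_implies_unstable_dominant {A B : Type} [Fintype A] [Fintype B]
    (P : PrefSys A B) (h : ∃ M, P.Popular M ∧ ¬ P.Stable M) :
    ∃ M, P.Dominant M ∧ ¬ P.Stable M := by
  obtain ⟨M, hM, hunst⟩ := h
  obtain ⟨σ, hσ⟩ := hM.1.exists_represents
  obtain ⟨α, hα⟩ := hM.exists_isWitness hσ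
  obtain ⟨τ, β, hτ, hβ, hne, heq⟩ := hα.exists_zero_imp_unmatched hσ.toIsMate
  obtain ⟨N, hN⟩ := PrefSys.exists_represents_of_isMate hτ
  refine ⟨N, hN.dominant hβ hne, fun hst => hunst ⟨hM.1, fun a b hab => hst.2 a b ?_⟩⟩
  rw [hσ.blocking_iff] at hab
  have hsum := hα.edge (x := .inl a) (y := .inr b) hab.1
  rw [StrictPrefs.vote_eq_one hab.2.1, StrictPrefs.vote_eq_one hab.2.2] at hsum
  have ha := hα.mem_Icc (.inl a)
  have hb := hα.mem_Icc (.inr b)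
  rw [hN.blocking_iff, heq _ (by omega), heq _ (by omega)]
  exact hab
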